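/- Let a = s + c be a solid simplicial affine cone in V with rational vertex s, where c is generated by linearly independent integral vectors v_1,…,v_d (d = dim V). Then S(a)(ξ) = ( Σ_{x ∈ (s+□(v_1,…,v_d)) ∩ Λ} e^{⟨ξ,x⟩} ) · ∏_{i=1}^d 1/(1 − e^{⟨ξ,v_i⟩}), where □(v_1,…,v_d) = Σ_i [0,1[ v_i is the semi-open parallelepiped; in particular S(a) extends to a meromorphic function on all of V*. -/

import Mathlib

open MeasureTheory Filter Topology Set
open scoped RealInnerProductSpace Pointwise BigOperators

noncomputable section

/-- the ambient rational vector space: `ℝ^d` with the standard inner product, which is used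
to identify `V` with its dual space `V^*`. -/
abbrev Vd (d : ℕ) := EuclideanSpace ℝ (Fin d)

variable {d : ℕ}

/-- the duality pairing `⟨ξ, x⟩` between `V^*` and `V`, realized by the standard inner
product of `ℝ^d`. -/
def pairE {d : ℕ} (ξ x : Vd d) : ℝ := @inner ℝ _ _ ξ x

/-- `Λ` is a lattice of its span: it is generated by finitely many `ℝ`-independent vectors. -/
def IsLatticeSub (Λ : AddSubgroup (Vd d)) : Prop :=
  ∃ (k : ℕ) (v : Fin k → Vd d), LinearIndependent ℝ v ∧
    Λ = AddSubgroup.closure (Set.range v)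

/-- `Λ` is a full-rank lattice in `ℝ^d`. -/
def IsFullLattice (Λ : AddSubgroup (Vd d)) : Prop :=
  IsLatticeSub Λ ∧ Submodule.span ℝ (Λ : Set (Vd d)) = ⊤

/-- `x` is a rational point with respect to the lattice `Λ`. -/
def IsRatPoint (Λ : AddSubgroup (Vd d)) (x : Vd d) : Prop :=
  ∃ q : ℤ, q ≠ 0 ∧ (q : ℝ) • x ∈ Λ

/-- viewing `φ ∈ V` as a linear functional via the standard pairing, it takes integer values
on `Λ`, i.e. it belongs to the dual lattice. -/
def IsDualIntegral (Λ : AddSubgroup (Vd d)) (φ : Vd d) : Prop :=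
  ∀ x ∈ Λ, ∃ n : ℤ, (pairE (φ) (x)) = (n : ℝ)

/-- a rational polyhedron (inside the span of `Λ`): a finite intersection of half-spaces
bounded by rational affine hyperplanes. -/
def IsRatPolyhedron (Λ : AddSubgroup (Vd d)) (P : Set (Vd d)) : Prop :=
  ∃ (n : ℕ) (φ : Fin n → Vd d) (c : Fin n → ℚ),
    (∀ i, IsDualIntegral Λ (φ i)) ∧
    P = {x | x ∈ Submodule.span ℝ (Λ : Set (Vd d)) ∧ ∀ i, (pairE (φ i) x) ≤ (c i : ℝ)}

/-- the set `P` contains a straight (affine) line. -/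
def ContainsLine (P : Set (Vd d)) : Prop :=
  ∃ x u : Vd d, u ≠ 0 ∧ ∀ t : ℝ, x + t • u ∈ P

/-- equality of meromorphic-type functions near `0`: they agree near `0` outside a closed
set with empty interior (the polar set). -/
def MeroEqAt0 (f g : Vd d → ℝ) : Prop :=
  ∃ Z : Set (Vd d), IsClosed Z ∧ interior Z = ∅ ∧
    ∀ᶠ ξ in 𝓝 (0 : Vd d), ξ ∉ Z → f ξ = g ξ

/-- `g` is analytic at `0` and its Taylor coefficients are rational with respect to an
integral basis (i.e. the coefficients take rational values on dual-lattice vectors). -/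
def HasRatSeriesAt0 (Λ : AddSubgroup (Vd d)) (g : Vd d → ℝ) : Prop :=
  ∃ p : FormalMultilinearSeries ℝ (Vd d) ℝ, HasFPowerSeriesAt g p 0 ∧
    ∀ (n : ℕ) (w : Fin n → Vd d), (∀ i, IsDualIntegral Λ (w i)) →
      ∃ q : ℚ, (p n) w = (q : ℝ)

/-- `f` is meromorphic near `0` with rational Taylor coefficients: near `0` it is a quotient
of two analytic functions with rational Taylor coefficients. -/
def RatMeromorphicAt0 (Λ : AddSubgroup (Vd d)) (f : Vd d → ℝ) : Prop :=
  ∃ g h : Vd d → ℝ, HasRatSeriesAt0 Λ g ∧ HasRatSeriesAt0 Λ h ∧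
    (¬ ∀ᶠ ξ in 𝓝 (0 : Vd d), h ξ = 0) ∧
    (∀ᶠ ξ in 𝓝 (0 : Vd d), h ξ ≠ 0 → f ξ * h ξ = g ξ)

/-- `m` is the canonical Lebesgue measure carried by the rational affine subspace `A`,
normalized so that a fundamental parallelepiped of the lattice `Λ ∩ lin(A)` has volume `1`:
it is the image of the standard Lebesgue measure under a `ℤ`-basis parametrization. -/
def IsCanonicalMeasure (Λ : AddSubgroup (Vd d)) (A : Set (Vd d)) (m : Measure (Vd d)) : Prop :=
  ∃ (k : ℕ) (x₀ : Vd d) (v : Fin k → Vd d),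
    x₀ ∈ A ∧ (∀ i, v i ∈ Λ) ∧ LinearIndependent ℝ v ∧
    A = {x | ∃ t : Fin k → ℝ, x = x₀ + ∑ i, t i • v i} ∧
    (∀ y ∈ Λ, y ∈ Submodule.span ℝ (Set.range v) →
      ∃ c : Fin k → ℤ, y = ∑ i, (c i : ℝ) • v i) ∧
    m = Measure.map (fun t : Fin k → ℝ => x₀ + ∑ i, t i • v i) volume

/-- the characterizing properties of the map `I`: it sends rational polyhedra to meromorphic
functions with rational coefficients, vanishes on polyhedra containing lines, and is given by
`∫_P e^{⟨ξ,x⟩} dm_{<P>}(x)` wherever this integral converges. -/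
def IsIMap (Λ : AddSubgroup (Vd d)) (I : Set (Vd d) → Vd d → ℝ) : Prop :=
  (∀ P, IsRatPolyhedron Λ P → RatMeromorphicAt0 Λ (I P)) ∧
  (∀ P, IsRatPolyhedron Λ P → ContainsLine P → ∀ ξ, I P ξ = 0) ∧
  (∀ P, IsRatPolyhedron Λ P → ∀ m : Measure (Vd d),
    IsCanonicalMeasure Λ ((affineSpan ℝ P : AffineSubspace ℝ (Vd d)) : Set (Vd d)) m →
    ∀ ξ : Vd d, IntegrableOn (fun x => Real.exp (pairE (ξ) (x))) P m →
      I P ξ = ∫ x in P, Real.exp (pairE (ξ) (x)) ∂m)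

/-- the characterizing properties of the map `S`: it sends rational polyhedra to meromorphic
functions with rational coefficients, vanishes on polyhedra containing lines, and is given by
`∑_{x ∈ P ∩ Λ} e^{⟨ξ,x⟩}` wherever this sum converges absolutely. -/
def IsSMap (Λ : AddSubgroup (Vd d)) (S : Set (Vd d) → Vd d → ℝ) : Prop :=
  (∀ P, IsRatPolyhedron Λ P → RatMeromorphicAt0 Λ (S P)) ∧
  (∀ P, IsRatPolyhedron Λ P → ContainsLine P → ∀ ξ, S P ξ = 0) ∧
  (∀ P, IsRatPolyhedron Λ P → ∀ ξ : Vd d,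
    Summable (fun x : ↥(P ∩ (Λ : Set (Vd d))) => Real.exp (pairE ξ (x : Vd d))) →
      S P ξ = ∑' x : ↥(P ∩ (Λ : Set (Vd d))), Real.exp (pairE ξ (x : Vd d)))

/-- `F` is a (nonempty, exposed) face of the convex set `P`. -/
def IsFaceOf (P F : Set (Vd d)) : Prop :=
  F.Nonempty ∧ ∃ φ : Vd d, F = {x ∈ P | ∀ y ∈ P, (pairE (φ) (y)) ≤ (pairE (φ) (x))}

/-- `v` is a vertex of `P`. -/
def IsVertexOf (P : Set (Vd d)) (v : Vd d) : Prop := IsFaceOf P {v}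

/-- the cone of feasible directions of `P` along the face `F` (computed at a point of the
relative interior of `F`). -/
def feasibleCone (P F : Set (Vd d)) : Set (Vd d) :=
  {u | ∃ x ∈ intrinsicInterior ℝ F, ∃ ε : ℝ, 0 < ε ∧ ∀ t : ℝ, 0 < t → t ≤ ε → x + t • u ∈ P}

/-- the supporting cone `<F> + c(P,F)` of `P` along its face `F`. -/
def suppCone (P F : Set (Vd d)) : Set (Vd d) :=
  {z | ∃ a ∈ (affineSpan ℝ F : Set (Vd d)), ∃ u ∈ feasibleCone P F, z = a + u}

/-- the recession cone (cone of directions) of a convex set. -/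
def recCone (P : Set (Vd d)) : Set (Vd d) :=
  {u | ∀ x ∈ P, ∀ t : ℝ, 0 ≤ t → x + t • u ∈ P}

/-- a rational affine cone with respect to the lattice `Λ`: a rational translate of a cone
generated by finitely many lattice vectors. -/
def IsRatAffineCone (Λ : AddSubgroup (Vd d)) (a : Set (Vd d)) : Prop :=
  ∃ (s : Vd d) (n : ℕ) (v : Fin n → Vd d), IsRatPoint Λ s ∧ (∀ i, v i ∈ Λ) ∧
    a = {x | ∃ t : Fin n → ℝ, (∀ i, 0 ≤ t i) ∧ x = s + ∑ i, t i • v i}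

/-- a rational (convex polyhedral) cone with vertex at the origin. -/
def IsRatCone (Λ : AddSubgroup (Vd d)) (c : Set (Vd d)) : Prop :=
  ∃ (n : ℕ) (v : Fin n → Vd d), (∀ i, v i ∈ Λ) ∧
    c = {x | ∃ t : Fin n → ℝ, (∀ i, 0 ≤ t i) ∧ x = ∑ i, t i • v i}

/-- `Q` is a rational scalar product: a symmetric positive definite bilinear form taking
rational values on lattice vectors. -/
def IsRatInner (Λ : AddSubgroup (Vd d)) (Q : Vd d →ₗ[ℝ] Vd d →ₗ[ℝ] ℝ) : Prop :=
  (∀ x y, Q x y = Q y x) ∧ (∀ x : Vd d, x ≠ 0 → 0 < Q x x) ∧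
  (∀ x ∈ Λ, ∀ y ∈ Λ, ∃ q : ℚ, Q x y = (q : ℝ))

/-- `π` realizes the quotient map `V → V/L` as the `Q`-orthogonal projection onto the
`Q`-orthogonal complement of `L`. -/
def IsQCoproj (Q : Vd d →ₗ[ℝ] Vd d →ₗ[ℝ] ℝ) (L : Submodule ℝ (Vd d))
    (π : Vd d →ₗ[ℝ] Vd d) : Prop :=
  (∀ x, x - π x ∈ L) ∧ (∀ x : Vd d, ∀ y ∈ L, Q (π x) y = 0)

/-- `Λ'` is the lattice of a rational quotient space of `(V, Λ)`, realized inside `V` via the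
`Q`-orthogonal projection along a rational subspace. -/
def IsQuotLattice (Q : Vd d →ₗ[ℝ] Vd d →ₗ[ℝ] ℝ) (Λ Λ' : AddSubgroup (Vd d)) : Prop :=
  ∃ (L : Submodule ℝ (Vd d)) (π : Vd d →ₗ[ℝ] Vd d),
    Submodule.span ℝ ((L : Set (Vd d)) ∩ (Λ : Set (Vd d))) = L ∧
    IsQCoproj Q L π ∧ Λ' = AddSubgroup.map π.toAddMonoidHom Λ

/-- a family of maps `I` indexed by the rational quotient spaces of `(V,Λ)`, each member
satisfying the characterizing properties of the integral generating function. -/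
def IsIFamily (Q : Vd d →ₗ[ℝ] Vd d →ₗ[ℝ] ℝ) (Λ : AddSubgroup (Vd d))
    (I : AddSubgroup (Vd d) → Set (Vd d) → Vd d → ℝ) : Prop :=
  ∀ Λ', IsQuotLattice Q Λ Λ' → IsIMap Λ' (I Λ')

/-- a family of maps `S` indexed by the rational quotient spaces of `(V,Λ)`, each member
satisfying the characterizing properties of the lattice-point generating function. -/
def IsSFamily (Q : Vd d →ₗ[ℝ] Vd d →ₗ[ℝ] ℝ) (Λ : AddSubgroup (Vd d))
    (S : AddSubgroup (Vd d) → Set (Vd d) → Vd d → ℝ) : Prop :=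
  ∀ Λ', IsQuotLattice Q Λ Λ' → IsSMap Λ' (S Λ')

/-- the defining properties (a),(b),(c) of the family `μ` of Berline--Vergne:
each `μ(a)` is meromorphic with rational coefficients near `0`, `μ_{0}({0}) = 1`, and for
every pointed rational affine cone `a` in a rational quotient `W` of `V` one has
`S(a) = ∑_{f ∈ F(a)} μ(t(a,f)) I(f)`, where the transverse cone `t(a,f)` is realized inside
`V` by the `Q`-orthogonal projection `π F` along `lin(f)`, and functions on quotient duals
are extended by `Q`-orthogonal projection. -/
def IsMuCore (Λ : AddSubgroup (Vd d)) (Q : Vd d →ₗ[ℝ] Vd d →ₗ[ℝ] ℝ)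
    (I S μ : AddSubgroup (Vd d) → Set (Vd d) → Vd d → ℝ) : Prop :=
  (∀ Λ', IsQuotLattice Q Λ Λ' → ∀ a, IsRatAffineCone Λ' a → ¬ ContainsLine a →
      RatMeromorphicAt0 Λ' (μ Λ' a)) ∧
  (∀ ξ, μ ⊥ ({0} : Set (Vd d)) ξ = 1) ∧
  (∀ Λ', IsQuotLattice Q Λ Λ' → ∀ a, IsRatAffineCone Λ' a → ¬ ContainsLine a →
    ∀ π : Set (Vd d) → (Vd d →ₗ[ℝ] Vd d),
      (∀ F, IsFaceOf a F → IsQCoproj Q (affineSpan ℝ F).direction (π F)) →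
      MeroEqAt0 (S Λ' a)
        (fun ξ => ∑ᶠ F ∈ {F | IsFaceOf a F},
          μ (AddSubgroup.map (π F).toAddMonoidHom Λ') ((π F) '' suppCone a F) ξ
            * I Λ' F ξ))

/-- the family `μ`, extended by `μ(a) = 0` on cones containing a straight line. -/
def IsMuFamily (Λ : AddSubgroup (Vd d)) (Q : Vd d →ₗ[ℝ] Vd d →ₗ[ℝ] ℝ)
    (I S μ : AddSubgroup (Vd d) → Set (Vd d) → Vd d → ℝ) : Prop :=
  IsMuCore Λ Q I S μ ∧
  (∀ Λ', IsQuotLattice Q Λ Λ' → ∀ a, IsRatAffineCone Λ' a → ContainsLine a →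
    ∀ ξ, μ Λ' a ξ = 0)

/-- the trace pairing of two `n`-multilinear forms on `ℝ^d`, computed in the standard basis. -/
def multiPair {n : ℕ} (p q : ContinuousMultilinearMap ℝ (fun _ : Fin n => Vd d) ℝ) : ℝ :=
  ∑ ι : Fin n → Fin d,
    p (fun j => (EuclideanSpace.basisFun (Fin d) ℝ) (ι j)) *
    q (fun j => (EuclideanSpace.basisFun (Fin d) ℝ) (ι j))

/-- the action on `h` of the infinite-order constant-coefficient differential operator whose
symbol has Taylor series `p` at `0`; on polynomials `h` the sum is finite.  Its defining
property is `D(Φ)e^{⟨ξ,·⟩} = Φ(ξ)e^{⟨ξ,·⟩}`. -/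
def DOp (p : FormalMultilinearSeries ℝ (Vd d) ℝ) (h : Vd d → ℝ) (x : Vd d) : ℝ :=
  ∑ᶠ n : ℕ, multiPair (p n) (iteratedFDeriv ℝ n h x)

/-- `h` is a polynomial function on `ℝ^d`. -/
def IsPolyFun (h : Vd d → ℝ) : Prop :=
  ∃ p : MvPolynomial (Fin d) ℝ, ∀ x : Vd d, h x = MvPolynomial.eval (fun i => x i) p

/-- `h` is a polynomial function of degree at most `r` on `ℝ^d`. -/
def IsPolyFunOfDeg (h : Vd d → ℝ) (r : ℕ) : Prop :=
  ∃ p : MvPolynomial (Fin d) ℝ, p.totalDegree ≤ r ∧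
    ∀ x : Vd d, h x = MvPolynomial.eval (fun i => x i) p

end

section Statement3Aux

/-- The multivariate geometric series. -/
theorem aux_geom (k : ℕ) (r : Fin k → ℝ) (h0 : ∀ i, 0 ≤ r i) (h1 : ∀ i, r i < 1) :
    HasSum (fun n : Fin k → ℕ => ∏ i, r i ^ n i) (∏ i, (1 - r i)⁻¹) := by
  induction k with
  | zero =>
    simp
  | succ k ih =>
    have h2 := ih (fun i => r i.succ) (fun i => h0 _) (fun i => h1 _)
    have h3 := hasSum_geometric_of_lt_one (h0 0) (h1 0)
    have h4 := h3.summable.mul_of_nonneg h2.summable (fun n => pow_nonneg (h0 0) n)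
      (fun n => Finset.prod_nonneg (fun i _ => pow_nonneg (h0 _) _))
    have h5 := h3.mul h2 h4
    rw [← (Fin.consEquiv (fun _ : Fin (k+1) => ℕ)).hasSum_iff]
    rw [Fin.prod_univ_succ]
    have hfe : (fun n : Fin (k+1) → ℕ => ∏ i, r i ^ n i) ∘ (Fin.consEquiv (fun _ => ℕ)) =
        fun x => r 0 ^ x.1 * ∏ i, r i.succ ^ x.2 i := by
      funext ⟨a, b⟩
      simp [Fin.prod_univ_succ, Fin.consEquiv]
    rw [hfe]
    exact h5

/-- The cone in coordinates. -/
theorem aux_cone_eq {d : ℕ} (B : Module.Basis (Fin d) ℝ (Vd d)) (s : Vd d)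
    (p : ℝ → Prop) :
    {x | ∃ t : Fin d → ℝ, (∀ i, p (t i)) ∧ x = s + ∑ i, t i • B i}
      = {x | ∀ i, p (B.repr (x - s) i)} := by
  ext x
  constructor
  · rintro ⟨t, ht, rfl⟩ i
    have : B.repr (∑ i, t i • B i) i = t i := by
      rw [B.repr_sum_self]
    rw [add_sub_cancel_left, this]
    exact ht i
  · intro hx
    refine ⟨fun i => B.repr (x - s) i, hx, ?_⟩
    rw [B.sum_repr]
    abel

/-- Lattice points in a bounded set are finite. -/
theorem aux_finite {d : ℕ} (Λ : AddSubgroup (Vd d)) (hΛ : IsFullLattice Λ) (A : Set (Vd d))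
    (hA : Bornology.IsBounded A) : (A ∩ (Λ : Set (Vd d))).Finite := by
  obtain ⟨⟨k, b, hb, rfl⟩, hsp⟩ := hΛ
  have hsp' : ⊤ ≤ Submodule.span ℝ (Set.range b) := by
    rw [← hsp, Submodule.span_le]
    intro x hx
    induction hx using AddSubgroup.closure_induction with
    | mem x hx => exact Submodule.subset_span hx
    | zero => exact Submodule.zero_mem _
    | add x y _ _ hx hy => exact Submodule.add_mem _ hx hy
    | neg x _ hx => exact Submodule.neg_mem _ hx
  have h := ZSpan.setFinite_inter (Module.Basis.mk hb hsp') hA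
  refine h.subset ?_
  rintro x ⟨hxA, hx⟩
  refine ⟨hxA, ?_⟩
  rw [Module.Basis.coe_mk]
  have hle : AddSubgroup.closure (Set.range b) ≤
      (Submodule.span ℤ (Set.range b)).toAddSubgroup :=
    (AddSubgroup.closure_le _).2 Submodule.subset_span
  exact hle hx

theorem aux_bounded {d : ℕ} (B : Module.Basis (Fin d) ℝ (Vd d)) (s : Vd d) :
    Bornology.IsBounded {x | ∀ i, 0 ≤ B.repr (x - s) i ∧ B.repr (x - s) i < 1} := by
  have hK : IsCompact (Set.pi Set.univ (fun _ : Fin d => Set.Icc (0:ℝ) 1)) :=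
    isCompact_univ_pi (fun _ => isCompact_Icc)
  have hc : Continuous (fun t : Fin d → ℝ => s + ∑ i, t i • B i) := by fun_prop
  refine (hK.image hc).isBounded.subset ?_
  intro x hx
  refine ⟨fun i => B.repr (x - s) i, fun i _ => ⟨(hx i).1, (hx i).2.le⟩, ?_⟩
  change s + ∑ i, (B.repr (x - s) i) • B i = x
  rw [B.sum_repr]
  abel

/-- subtracting integral multiples of the basis -/
theorem aux_repr_sub {d : ℕ} (B : Module.Basis (Fin d) ℝ (Vd d)) (x : Vd d) (n : Fin d → ℤ)
    (i : Fin d) : B.repr (x - ∑ j, n j • B j) i = B.repr x i - n i := by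
  have : B.repr (∑ j, n j • B j) i = n i := by
    have h2 : (∑ j, n j • B j) = ∑ j, (n j : ℝ) • B j := by
      simp only [Int.cast_smul_eq_zsmul]
    rw [h2, B.repr_sum_self]
  rw [map_sub, Finsupp.sub_apply, this]

theorem aux_mem {d : ℕ} (Λ : AddSubgroup (Vd d)) (B : Module.Basis (Fin d) ℝ (Vd d))
    (hB : ∀ i, B i ∈ Λ) (n : Fin d → ℤ) : ∑ j, n j • B j ∈ Λ :=
  AddSubgroup.sum_mem _ (fun i _ => AddSubgroup.zsmul_mem _ (hB i) _)

/-- A common denominator for the coordinates of lattice points. -/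
theorem aux_denom {d : ℕ} (Λ : AddSubgroup (Vd d)) (hΛ : IsFullLattice Λ)
    (B : Module.Basis (Fin d) ℝ (Vd d)) (hB : ∀ i, B i ∈ Λ) :
    ∃ N : ℕ, 0 < N ∧ ∀ x ∈ Λ, ∀ i, ∃ m : ℤ, (N : ℝ) * B.repr x i = m := by
  classical
  have hfin := aux_finite Λ hΛ _ (aux_bounded B 0)
  simp only [sub_zero] at hfin
  set A := {x | ∀ i, 0 ≤ B.repr x i ∧ B.repr x i < 1} ∩ (Λ : Set (Vd d)) with hA
  -- reduction
  have hred : ∀ x ∈ Λ, ∃ n : Fin d → ℤ, x - ∑ j, n j • B j ∈ A := by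
    intro x hx
    refine ⟨fun j => ⌊B.repr x j⌋, ?_, sub_mem hx (aux_mem Λ B hB _)⟩
    intro i
    rw [aux_repr_sub]
    exact ⟨Int.fract_nonneg _, Int.fract_lt_one _⟩
  -- torsion
  have htor : ∀ x ∈ Λ, ∃ N : ℕ, 0 < N ∧ ∀ i, ∃ m : ℤ, (N : ℝ) * B.repr x i = m := by
    intro x hx
    have h1 : ∀ k : ℕ, ∃ n : Fin d → ℤ, k • x - ∑ j, n j • B j ∈ A :=
      fun k => hred _ (AddSubgroup.nsmul_mem _ hx k)
    choose n hn using h1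
    have : Finite A := hfin
    obtain ⟨k, l, hkl, heq⟩ := Finite.exists_ne_map_eq_of_infinite
      (fun k : ℕ => (⟨_, hn k⟩ : A))
    have heq' : k • x - ∑ j, n k j • B j = l • x - ∑ j, n l j • B j := congrArg Subtype.val heq
    have key : ∀ i, (k : ℝ) * B.repr x i - n k i = (l : ℝ) * B.repr x i - n l i := by
      intro i
      have := congrArg (fun y => B.repr y i) heq'
      simp only [aux_repr_sub] at this
      simpa using this
    rcases lt_or_gt_of_ne hkl with h | h
    · refine ⟨l - k, Nat.sub_pos_of_lt h, fun i => ⟨n l i - n k i, ?_⟩⟩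
      rw [Nat.cast_sub h.le]
      push_cast
      linarith [key i]
    · refine ⟨k - l, Nat.sub_pos_of_lt h, fun i => ⟨n k i - n l i, ?_⟩⟩
      rw [Nat.cast_sub h.le]
      push_cast
      linarith [key i]
  have htor' : ∀ x : Vd d, ∃ N : ℕ, 0 < N ∧
      (x ∈ Λ → ∀ i, ∃ m : ℤ, (N : ℝ) * B.repr x i = m) := by
    intro x
    by_cases hx : x ∈ Λ
    · obtain ⟨N, h1, h2⟩ := htor x hx
      exact ⟨N, h1, fun _ => h2⟩
    · exact ⟨1, one_pos, fun h => absurd h hx⟩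
  choose F hF0 hF using htor'
  refine ⟨∏ x ∈ hfin.toFinset, F x, Finset.prod_pos (fun x _ => hF0 x), ?_⟩
  intro x hx i
  obtain ⟨n, hn⟩ := hred x hx
  set y := x - ∑ j, n j • B j with hy
  obtain ⟨m, hm⟩ := hF y hn.2 i
  obtain ⟨c, hc⟩ := Finset.dvd_prod_of_mem F (hfin.mem_toFinset.2 hn)
  have hyi : B.repr y i = B.repr x i - n i := aux_repr_sub B x n i
  refine ⟨c * m + (F y * c : ℕ) * n i, ?_⟩
  rw [hc]
  push_cast
  rw [← hm, hyi]
  ring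

/-- the dual basis vector -/
theorem aux_dual {d : ℕ} (f : Vd d →ₗ[ℝ] ℝ) : ∃ φ : Vd d, ∀ x, pairE φ x = f x :=
  ⟨(InnerProductSpace.toDual ℝ (Vd d)).symm (LinearMap.toContinuousLinearMap f), fun x => by
    unfold pairE
    rw [InnerProductSpace.toDual_symm_apply]
    rfl⟩

/-- The simplicial cone is a rational polyhedron. -/
theorem aux_poly {d : ℕ} (Λ : AddSubgroup (Vd d)) (hΛ : IsFullLattice Λ)
    (B : Module.Basis (Fin d) ℝ (Vd d)) (hB : ∀ i, B i ∈ Λ) (s : Vd d) (hs : IsRatPoint Λ s) :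
    IsRatPolyhedron Λ {x | ∀ i, 0 ≤ B.repr (x - s) i} := by
  obtain ⟨N, hN, hNx⟩ := aux_denom Λ hΛ B hB
  obtain ⟨q, hq, hqs⟩ := hs
  have hφ : ∀ i, ∃ φ : Vd d, ∀ x, pairE φ x = -(N : ℝ) * B.repr x i := by
    intro i
    obtain ⟨φ, h⟩ := aux_dual ((-(N : ℝ)) • B.coord i)
    exact ⟨φ, fun x => by rw [h]; simp⟩
  choose φ hφ using hφ
  choose m hm using fun i => hNx _ hqs i
  have hqR : (q : ℝ) ≠ 0 := by exact_mod_cast hq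
  refine ⟨d, φ, fun i => -(m i : ℚ) / q, ?_, ?_⟩
  · intro i x hx
    obtain ⟨k, hk⟩ := hNx x hx i
    refine ⟨-k, ?_⟩
    rw [hφ]
    push_cast
    linarith
  · ext x
    simp only [hΛ.2, Submodule.mem_top, true_and, Set.mem_ofPred_eq]
    refine forall_congr' fun i => ?_
    have h1 : ((-(m i : ℚ) / q : ℚ) : ℝ) = -(N : ℝ) * B.repr s i := by
      push_cast
      rw [← hm i]
      simp only [map_smul, Finsupp.smul_apply, smul_eq_mul]
      field_simp
    rw [h1, hφ, map_sub, Finsupp.sub_apply]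
    have hN' : (0 : ℝ) < N := by exact_mod_cast hN
    constructor
    · intro h
      nlinarith
    · intro h
      have : (N : ℝ) * B.repr s i ≤ N * B.repr x i := by linarith
      linarith [le_of_mul_le_mul_left this hN']

theorem aux_pair_add {d : ℕ} (ξ x y : Vd d) : pairE ξ (x + y) = pairE ξ x + pairE ξ y := by
  unfold pairE; exact inner_add_right _ _ _

theorem aux_pair_sum {d : ℕ} (ξ : Vd d) (v : Fin d → Vd d) (n : Fin d → ℕ) :
    pairE ξ (∑ j, n j • v j) = ∑ j, n j * pairE ξ (v j) := by
  unfold pairE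
  rw [inner_sum]
  refine Finset.sum_congr rfl fun j _ => ?_
  rw [← Nat.cast_smul_eq_nsmul ℝ, inner_smul_right]

/-- box times naturals is the cone -/
theorem aux_equiv {d : ℕ} (Λ : AddSubgroup (Vd d))
    (B : Module.Basis (Fin d) ℝ (Vd d)) (hB : ∀ i, B i ∈ Λ) (s : Vd d) :
    ∃ e : (↥({x | ∀ i, 0 ≤ B.repr (x - s) i ∧ B.repr (x - s) i < 1} ∩ (Λ : Set (Vd d))) ×
        (Fin d → ℕ)) ≃ ↥({x | ∀ i, 0 ≤ B.repr (x - s) i} ∩ (Λ : Set (Vd d))),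
      ∀ p, (e p : Vd d) = p.1 + ∑ j, p.2 j • B j := by
  have hcoord : ∀ (x : Vd d) (n : Fin d → ℕ) (i : Fin d),
      B.repr (x + ∑ j, n j • B j - s) i = B.repr (x - s) i + n i := by
    intro x n i
    have := aux_repr_sub B (x - s) (fun j => -(n j : ℤ)) i
    simp only [neg_smul, Finset.sum_neg_distrib, natCast_zsmul, Int.cast_neg,
      Int.cast_natCast, sub_neg_eq_add] at this
    rw [← this, add_sub_right_comm]
  let f : (↥({x | ∀ i, 0 ≤ B.repr (x - s) i ∧ B.repr (x - s) i < 1} ∩ (Λ : Set (Vd d))) ×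
        (Fin d → ℕ)) → ↥({x | ∀ i, 0 ≤ B.repr (x - s) i} ∩ (Λ : Set (Vd d))) :=
    fun p => ⟨p.1 + ∑ j, p.2 j • B j, fun i => by
        rw [hcoord]
        have := (p.1.2.1 i).1
        positivity,
      add_mem p.1.2.2 (AddSubgroup.sum_mem _ (fun i _ => AddSubgroup.nsmul_mem _ (hB i) _))⟩
  have hf : Function.Bijective f := by
    constructor
    · rintro ⟨⟨x, hx⟩, n⟩ ⟨⟨y, hy⟩, k⟩ h
      have h' : x + ∑ j, n j • B j = y + ∑ j, k j • B j := congrArg Subtype.val h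
      have hnk : n = k := by
        funext i
        have h1 : B.repr (x - s) i + n i = B.repr (y - s) i + k i := by
          rw [← hcoord, ← hcoord, h']
        have hxi := hx.1 i
        have hyi := hy.1 i
        have h2 : (n i : ℝ) < k i + 1 := by linarith
        have h3 : (k i : ℝ) < n i + 1 := by linarith
        have h2' : n i < k i + 1 := by exact_mod_cast h2
        have h3' : k i < n i + 1 := by exact_mod_cast h3
        omega
      subst hnk
      have := add_right_cancel h'
      subst this
      rfl
    · rintro ⟨z, hz⟩
      have hn : ∀ i, (⌊B.repr (z - s) i⌋₊ : ℝ) ≤ B.repr (z - s) i := fun i =>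
        Nat.floor_le (hz.1 i)
      have hz' : (z - ∑ j, ⌊B.repr (z - s) j⌋₊ • B j) + ∑ j, ⌊B.repr (z - s) j⌋₊ • B j = z :=
        sub_add_cancel _ _
      refine ⟨⟨⟨z - ∑ j, ⌊B.repr (z - s) j⌋₊ • B j, ?_, ?_⟩,
        fun j => ⌊B.repr (z - s) j⌋₊⟩, Subtype.ext hz'⟩
      · intro i
        have h1 := hcoord (z - ∑ j, ⌊B.repr (z - s) j⌋₊ • B j) (fun j => ⌊B.repr (z - s) j⌋₊) i
        rw [hz'] at h1
        have h2 := Nat.lt_floor_add_one (B.repr (z - s) i)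
        have h3 := hn i
        constructor
        · linarith
        · linarith
      · exact sub_mem hz.2
          (AddSubgroup.sum_mem _ (fun i _ => AddSubgroup.nsmul_mem _ (hB i) _))
  exact ⟨Equiv.ofBijective f hf, fun p => rfl⟩

/-- The generating function on the convergence domain. -/
theorem aux_hasSum {d : ℕ} (Λ : AddSubgroup (Vd d)) (hΛ : IsFullLattice Λ)
    (B : Module.Basis (Fin d) ℝ (Vd d)) (hB : ∀ i, B i ∈ Λ) (s ξ : Vd d)
    (hξ : ∀ i, pairE ξ (B i) < 0) :
    HasSum (fun x : ↥({x | ∀ i, 0 ≤ B.repr (x - s) i} ∩ (Λ : Set (Vd d))) =>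
        Real.exp (pairE ξ (x : Vd d)))
      ((∑ x ∈ (aux_finite Λ hΛ _ (aux_bounded B s)).toFinset, Real.exp (pairE ξ x)) *
        ∏ i, (1 - Real.exp (pairE ξ (B i)))⁻¹) := by
  have hfin := aux_finite Λ hΛ _ (aux_bounded B s)
  obtain ⟨e, he⟩ := aux_equiv Λ B hB s
  rw [← e.hasSum_iff]
  have : Fintype ↥({x | ∀ i, 0 ≤ B.repr (x - s) i ∧ B.repr (x - s) i < 1} ∩ (Λ : Set (Vd d))) :=
    hfin.fintype
  have h1 := hasSum_fintype (fun x : ↥({x | ∀ i, 0 ≤ B.repr (x - s) i ∧ B.repr (x - s) i < 1} ∩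
    (Λ : Set (Vd d))) => Real.exp (pairE ξ (x : Vd d)))
  have h2 := aux_geom d (fun i => Real.exp (pairE ξ (B i))) (fun i => (Real.exp_pos _).le)
    (fun i => Real.exp_lt_one_iff.2 (hξ i))
  have h3 := h1.summable.mul_of_nonneg h2.summable (fun n => (Real.exp_pos _).le)
      (fun n => Finset.prod_nonneg (fun i _ => pow_nonneg (Real.exp_pos _).le _))
  have h4 := h1.mul h2 h3
  rw [Finset.sum_subtype (aux_finite Λ hΛ _ (aux_bounded B s)).toFinset
    (fun x => Set.Finite.mem_toFinset _) (fun x => Real.exp (pairE ξ x))]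
  refine (congrArg (fun F => HasSum F _) (funext fun p => ?_)).mpr h4
  change Real.exp (pairE ξ (e p : Vd d)) = _
  rw [he, aux_pair_add, Real.exp_add, aux_pair_sum, Real.exp_sum]
  simp only [Real.exp_nat_mul]

theorem aux_an {d : ℕ} (x ξ : Vd d) : AnalyticAt ℝ (fun ξ : Vd d => Real.exp (pairE ξ x)) ξ := by
  have h : AnalyticAt ℝ (fun ξ : Vd d => pairE ξ x) ξ := by
    have : (fun ξ : Vd d => pairE ξ x) = fun ξ => innerSL ℝ x ξ := by
      funext ξ
      simp [pairE, real_inner_comm]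
    rw [this]
    exact (innerSL ℝ x).analyticAt ξ
  exact h.rexp

/-- The identity-theorem part of the argument. -/
theorem aux_mero {d : ℕ} (Λ : AddSubgroup (Vd d)) (f N D : Vd d → ℝ)
    (hf : RatMeromorphicAt0 Λ f) (hN : ∀ ξ, AnalyticAt ℝ N ξ) (hD : ∀ ξ, AnalyticAt ℝ D ξ)
    (C : Set (Vd d)) (hC : IsOpen C) (hC0 : (0 : Vd d) ∈ closure C)
    (hDC : ∀ ξ ∈ C, D ξ ≠ 0) (hfC : ∀ ξ ∈ C, f ξ = N ξ * (D ξ)⁻¹) :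
    MeroEqAt0 f (fun ξ => N ξ * (D ξ)⁻¹) := by
  obtain ⟨g, h, ⟨pg, hg, -⟩, ⟨ph, hh, -⟩, hh0, hfg⟩ := hf
  have hg' := hg.analyticAt.eventually_analyticAt
  have hh' := hh.analyticAt.eventually_analyticAt
  obtain ⟨r, hr, hball⟩ := Metric.eventually_nhds_iff_ball.1 (hg'.and (hh'.and hfg))
  have hpre : IsPreconnected (Metric.ball (0 : Vd d) r) := (convex_ball _ _).isPreconnected
  have h0b : (0 : Vd d) ∈ Metric.ball (0 : Vd d) r := Metric.mem_ball_self hr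
  have hgan : AnalyticOnNhd ℝ g (Metric.ball 0 r) := fun x hx => (hball x hx).1
  have hhan : AnalyticOnNhd ℝ h (Metric.ball 0 r) := fun x hx => (hball x hx).2.1
  have hNan : AnalyticOnNhd ℝ N (Metric.ball 0 r) := fun x hx => hN x
  have hDan : AnalyticOnNhd ℝ D (Metric.ball 0 r) := fun x hx => hD x
  have hhnot : ∀ z ∈ Metric.ball (0 : Vd d) r, ¬ (h =ᶠ[𝓝 z] 0) := by
    intro z hz hzero
    have := hhan.eqOn_zero_of_preconnected_of_eventuallyEq_zero hpre hz hzero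
    exact hh0 (Filter.mem_of_superset (Metric.ball_mem_nhds _ hr) this)
  -- a point of the cone where `h` does not vanish
  obtain ⟨z, hzb, hzC, hzh⟩ : ∃ z ∈ Metric.ball (0 : Vd d) r, z ∈ C ∧ h z ≠ 0 := by
    obtain ⟨c, hcb, hcC⟩ := mem_closure_iff.1 hC0 _ Metric.isOpen_ball h0b
    by_contra hcon
    push Not at hcon
    apply hhnot c hcb
    filter_upwards [Metric.isOpen_ball.mem_nhds hcb, hC.mem_nhds hcC] with y hy1 hy2
    exact hcon y hy1 hy2
  have hid : Set.EqOn (fun ξ => g ξ * D ξ) (fun ξ => N ξ * h ξ) (Metric.ball 0 r) := by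
    refine AnalyticOnNhd.eqOn_of_preconnected_of_eventuallyEq
      (hgan.mul hDan) (hNan.mul hhan) hpre hzb ?_
    filter_upwards [Metric.isOpen_ball.mem_nhds hzb, hC.mem_nhds hzC,
      (hhan z hzb).continuousAt.eventually_ne hzh] with y hy1 hy2 hy3
    rw [← (hball y hy1).2.2 hy3, hfC y hy2]
    have := hDC y hy2
    field_simp
  refine ⟨Metric.closedBall 0 (r/2) ∩ (fun ξ => h ξ * D ξ) ⁻¹' {0}, ?_, ?_, ?_⟩
  · refine ContinuousOn.preimage_isClosed_of_isClosed ?_ Metric.isClosed_closedBall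
      isClosed_singleton
    exact (hhan.mul hDan).continuousOn.mono
      (Metric.closedBall_subset_ball (by linarith))
  · rw [Set.eq_empty_iff_forall_notMem]
    intro w hw
    have hwb : w ∈ Metric.ball (0 : Vd d) r :=
      Metric.closedBall_subset_ball (by linarith) (interior_subset hw).1
    have := (hhan.mul hDan).eqOn_zero_of_preconnected_of_eventuallyEq_zero hpre hwb (by
      filter_upwards [isOpen_interior.mem_nhds hw] with y hy
      exact (interior_subset hy).2)
    exact mul_ne_zero hzh (hDC z hzC) (this hzb)
  · filter_upwards [Metric.ball_mem_nhds (0 : Vd d) (half_pos hr)] with ξ hξ hξZ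
    have hξb : ξ ∈ Metric.ball (0 : Vd d) r := Metric.ball_subset_ball (by linarith) hξ
    have hne : h ξ * D ξ ≠ 0 := fun h0 => hξZ ⟨Metric.ball_subset_closedBall hξ, h0⟩
    have hh1 : h ξ ≠ 0 := left_ne_zero_of_mul hne
    have hD1 : D ξ ≠ 0 := right_ne_zero_of_mul hne
    have e1 := (hball ξ hξb).2.2 hh1
    have e2 : g ξ * D ξ = N ξ * h ξ := hid hξb
    change f ξ = N ξ * (D ξ)⁻¹
    rw [← div_eq_mul_inv, eq_div_iff hD1]
    apply mul_right_cancel₀ hh1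
    rw [← e2, ← e1]
    ring

end Statement3Aux

/-- for a solid simplicial affine cone `a = s + c` with rational vertex `s` and
`c` generated by `d` linearly independent integral vectors `v₁,…,v_d`,
`S(a)(ξ) = (∑_{x ∈ (s+□(v)) ∩ Λ} e^{⟨ξ,x⟩}) ∏ᵢ (1 − e^{⟨ξ,vᵢ⟩})⁻¹` as meromorphic
functions; in particular `S(a)` is (the restriction of) a meromorphic function on `V^*`. -/
theorem statement3 (d : ℕ) (Λ : AddSubgroup (Vd d)) (hΛ : IsFullLattice Λ)
    (S : Set (Vd d) → Vd d → ℝ) (hS : IsSMap Λ S)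
    (s : Vd d) (hs : IsRatPoint Λ s)
    (v : Fin d → Vd d) (hvind : LinearIndependent ℝ v) (hv : ∀ i, v i ∈ Λ) :
    MeroEqAt0
      (S {x | ∃ t : Fin d → ℝ, (∀ i, 0 ≤ t i) ∧ x = s + ∑ i, t i • v i})
      (fun ξ =>
        (∑ᶠ x ∈ ({x | ∃ t : Fin d → ℝ, (∀ i, 0 ≤ t i ∧ t i < 1) ∧ x = s + ∑ i, t i • v i}
            ∩ (Λ : Set (Vd d))), Real.exp (pairE ξ x)) *
        ∏ i, (1 - Real.exp (pairE ξ (v i)))⁻¹) := by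
  have hcard : Fintype.card (Fin d) = Module.finrank ℝ (Vd d) := by simp
  have hsp : ⊤ ≤ Submodule.span ℝ (Set.range v) :=
    (hvind.span_eq_top_of_card_eq_finrank' hcard).ge
  obtain ⟨B, hBv⟩ : ∃ B : Module.Basis (Fin d) ℝ (Vd d), ⇑B = v :=
    ⟨Module.Basis.mk hvind hsp, Module.Basis.coe_mk _ _⟩
  subst hBv
  rw [aux_cone_eq B s (fun t => 0 ≤ t), aux_cone_eq B s (fun t => 0 ≤ t ∧ t < 1)]
  have hpoly := aux_poly Λ hΛ B hv s hs
  have hfin := aux_finite Λ hΛ _ (aux_bounded B s)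
  simp only [finsum_mem_eq_finite_toFinset_sum _ hfin, Finset.prod_inv_distrib]
  refine aux_mero Λ _ _ _ (hS.1 _ hpoly) ?_ ?_ {ξ | ∀ i, pairE ξ (B i) < 0} ?_ ?_ ?_ ?_
  · intro ξ
    exact Finset.analyticAt_fun_sum _ (fun x _ => aux_an x ξ)
  · intro ξ
    exact Finset.analyticAt_fun_prod _ (fun i _ => analyticAt_const.sub (aux_an _ ξ))
  · simp only [Set.ofPred_forall]
    refine isOpen_iInter_of_finite fun i => ?_
    refine isOpen_lt ?_ continuous_const
    unfold pairE
    fun_prop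
  · obtain ⟨φ, hφ⟩ := aux_dual (-∑ i, B.coord i)
    have hφB : ∀ i, pairE φ (B i) = -1 := by
      intro i
      rw [hφ]
      simp [Finsupp.single_apply]
    have ht : Tendsto (fun n : ℕ => (1 / ((n : ℝ) + 1)) • φ) atTop (𝓝 0) := by
      have := (tendsto_one_div_add_atTop_nhds_zero_nat (𝕜 := ℝ)).smul_const φ
      simpa using this
    refine mem_closure_of_tendsto ht (Eventually.of_forall fun n i => ?_)
    have : pairE ((1 / ((n : ℝ) + 1)) • φ) (B i) = (1 / ((n : ℝ) + 1)) * pairE φ (B i) := by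
      unfold pairE
      rw [real_inner_smul_left]
    rw [this, hφB]
    have : 0 < 1 / ((n : ℝ) + 1) := by positivity
    linarith
  · intro ξ hξ
    refine Finset.prod_ne_zero_iff.2 fun i _ => ?_
    have := Real.exp_lt_one_iff.2 (hξ i)
    linarith
  · intro ξ hξ
    have h := aux_hasSum Λ hΛ B hv s ξ hξ
    rw [hS.2.2 _ hpoly ξ h.summable, h.tsum_eq, Finset.prod_inv_distrib]
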